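/- arXiv:1810.11499 — 4 statements merged into one kernel-verified Lean document; each statement's English description precedes it below -/
import Mathlib

section
/- Let d, m be positive integers, let Σ₁ and Σ₂ be d×d real symmetric positive-definite matrices, let β > 1 be real, and let A be an m×d real matrix satisfying the stationarity equation (1−β)·(AΣ₂Aᵀ + I_m)⁻¹·A·Σ₂ + β·(AΣ₁Aᵀ + I_m)⁻¹·A·Σ₁ = 0. Then A satisfies the generalized eigenvector equation A·(Σ₁·Σ₂⁻¹) = ((β−1)/β)·(AΣ₁Aᵀ + I_m)·(AΣ₂Aᵀ + I_m)⁻¹·A. -/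
open Matrix

/-- If `A` satisfies the stationarity equation
`(1−β)·(AΣ₂Aᵀ + I)⁻¹·A·Σ₂ + β·(AΣ₁Aᵀ + I)⁻¹·A·Σ₁ = 0` with `Σ₁, Σ₂` symmetric
positive definite and `β > 1`, then `A` satisfies the generalized eigenvector
equation `A·(Σ₁·Σ₂⁻¹) = ((β−1)/β)·(AΣ₁Aᵀ + I)·(AΣ₂Aᵀ + I)⁻¹·A`. -/
theorem stmt_0 (d m : ℕ) (hd : 0 < d) (hm : 0 < m)
    (S1 S2 : Matrix (Fin d) (Fin d) ℝ)
    (hS1 : S1.PosDef) (hS2 : S2.PosDef)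
    (β : ℝ) (hβ : 1 < β)
    (A : Matrix (Fin m) (Fin d) ℝ)
    (hstat : (1 - β) • ((A * S2 * Aᵀ + 1)⁻¹ * A * S2)
              + β • ((A * S1 * Aᵀ + 1)⁻¹ * A * S1) = 0) :
    A * (S1 * S2⁻¹)
      = ((β - 1) / β) • ((A * S1 * Aᵀ + 1) * (A * S2 * Aᵀ + 1)⁻¹ * A) := by
  have hP : IsUnit (A * S1 * Aᵀ + 1).det := by
    have hpsd : (A * S1 * Aᵀ).PosSemidef := by
      simpa using hS1.posSemidef.mul_mul_conjTranspose_same A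
    exact (Matrix.isUnit_iff_isUnit_det _).1 (PosDef.posSemidef_add hpsd PosDef.one).isUnit
  have hS : IsUnit S2.det := (Matrix.isUnit_iff_isUnit_det _).1 hS2.isUnit
  generalize (A * S2 * Aᵀ + 1)⁻¹ = R at *
  generalize A * S1 * Aᵀ + 1 = P at *
  have hβ0 : β ≠ 0 := by linarith
  have h := congrArg (fun X => P * X * S2⁻¹) hstat
  simp only [Matrix.mul_add, Matrix.add_mul, Matrix.mul_smul, Matrix.smul_mul, Matrix.mul_assoc,
    Matrix.mul_nonsing_inv _ hS, Matrix.mul_nonsing_inv_cancel_left _ _ hP, Matrix.mul_one,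
    Matrix.mul_zero, Matrix.zero_mul] at h
  have h' : β • (A * (S1 * S2⁻¹)) = (β - 1) • (P * (R * A)) := by
    rw [eq_neg_of_add_eq_zero_right h, ← neg_smul, neg_sub]
  rw [Matrix.mul_assoc, div_eq_inv_mul, mul_smul, ← h', inv_smul_smul₀ hβ0]
end

section
/- Let λ, s, β be real numbers with 0 < λ < 1, s > 0, and β > 1/(1−λ). Define g : ℝ → ℝ by g(a) = (1−β)·log(s·a² + 1) + β·log(λ·s·a² + 1). Then g attains its minimum over ℝ exactly at the points a with a² = (β(1−λ) − 1)/(λ·s); that is, g(a*) ≤ g(a) for all a ∈ ℝ when a*² = (β(1−λ)−1)/(λ·s), and any minimizer a of g satisfies a² = (β(1−λ)−1)/(λ·s). -/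
/-- Strict concavity of the logarithm between `1` and `w`, with weights `1/β` and `(β-1)/β`. -/
lemma sub_one_mul_log_lt {β w : ℝ} (hβ : 1 < β) (hw : 0 < w) (hw1 : w ≠ 1) :
    (β - 1) * Real.log w < β * Real.log (((β - 1) * w + 1) / β) := by
  have hβ0 : 0 < β := by linarith
  have h := strictConcaveOn_log_Ioi.2 (Set.mem_Ioi.2 hw) (Set.mem_Ioi.2 one_pos) hw1
    (div_pos (sub_pos.2 hβ) hβ0) (one_div_pos.2 hβ0) (by field_simp; ring)
  simp only [smul_eq_mul, Real.log_one, mul_zero, add_zero, mul_one] at h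
  rw [show (β - 1) / β * w + 1 / β = ((β - 1) * w + 1) / β by ring] at h
  calc (β - 1) * Real.log w = β * ((β - 1) / β * Real.log w) := by field_simp
    _ < _ := mul_lt_mul_of_pos_left h hβ0

/-- The Lagrangian, as a function of the squared gain `t`, is strictly smaller at the optimal
squared gain than at any other. -/
lemma lagrangian_lt_of_ne {lam s β t : ℝ} (hlam0 : 0 < lam) (hlam1 : lam < 1) (hs : 0 < s)
    (hβ : 1 < β) (ht : 0 ≤ t) (hne : t ≠ (β * (1 - lam) - 1) / (lam * s)) :
    (1 - β) * Real.log (s * ((β * (1 - lam) - 1) / (lam * s)) + 1)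
        + β * Real.log (lam * s * ((β * (1 - lam) - 1) / (lam * s)) + 1)
      < (1 - β) * Real.log (s * t + 1) + β * Real.log (lam * s * t + 1) := by
  have hl : 0 < 1 - lam := sub_pos.2 hlam1
  have hβ1 : 0 < β - 1 := sub_pos.2 hβ
  have hβ0 : 0 < β := by linarith
  have hu : 0 < s * t + 1 := by positivity
  have hv : 0 < lam * s * t + 1 := by positivity
  have hu₀ : s * ((β * (1 - lam) - 1) / (lam * s)) + 1 = (β - 1) * (1 - lam) / lam := by
    field_simp
    ring
  have hv₀ : lam * s * ((β * (1 - lam) - 1) / (lam * s)) + 1 = β * (1 - lam) := by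
    field_simp
    ring
  have hu₀pos : 0 < (β - 1) * (1 - lam) / lam := by positivity
  have hv₀pos : 0 < β * (1 - lam) := by positivity
  have hw1 : (s * t + 1) / ((β - 1) * (1 - lam) / lam) ≠ 1 := by
    intro h
    rw [div_eq_one_iff_eq hu₀pos.ne', ← hu₀] at h
    exact hne (mul_left_cancel₀ hs.ne' (add_right_cancel h))
  have hz : ((β - 1) * ((s * t + 1) / ((β - 1) * (1 - lam) / lam)) + 1) / β
      = (lam * s * t + 1) / (β * (1 - lam)) := by
    field_simp
    ring
  have h := sub_one_mul_log_lt hβ (div_pos hu hu₀pos) hw1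
  rw [hz, Real.log_div hu.ne' hu₀pos.ne', Real.log_div hv.ne' hv₀pos.ne'] at h
  rw [hu₀, hv₀]
  linarith

/-- **scalar case of Theorem 1.** For `0 < λ < 1`, `s > 0` and
`β > 1/(1−λ)`, the function `g(a) = (1−β)·log(s·a² + 1) + β·log(λ·s·a² + 1)`
attains its minimum over `ℝ` exactly at the points with
`a² = (β(1−λ) − 1)/(λ·s)`. -/
theorem stmt_6 (lam s β : ℝ) (hlam0 : 0 < lam) (hlam1 : lam < 1) (hs : 0 < s)
    (hβ : 1 / (1 - lam) < β)
    (g : ℝ → ℝ)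
    (hg : ∀ a : ℝ, g a = (1 - β) * Real.log (s * a ^ 2 + 1)
        + β * Real.log (lam * s * a ^ 2 + 1)) :
    (∀ a : ℝ, a ^ 2 = (β * (1 - lam) - 1) / (lam * s) → ∀ b : ℝ, g a ≤ g b)
    ∧ (∀ a : ℝ, (∀ b : ℝ, g a ≤ g b) → a ^ 2 = (β * (1 - lam) - 1) / (lam * s)) := by
  have hl : 0 < 1 - lam := sub_pos.2 hlam1
  have hβl : 1 < β * (1 - lam) := (div_lt_iff₀ hl).1 hβ
  have hβ1 : 1 < β := lt_of_le_of_lt ((one_le_div hl).2 (by linarith)) hβ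
  have key : ∀ a b : ℝ, a ^ 2 = (β * (1 - lam) - 1) / (lam * s) →
      b ^ 2 ≠ (β * (1 - lam) - 1) / (lam * s) → g a < g b := by
    intro a b ha hb
    rw [hg, hg, ha]
    exact lagrangian_lt_of_ne hlam0 hlam1 hs hβ1 (sq_nonneg b) hb
  refine ⟨fun a ha b => ?_, fun a ha => ?_⟩
  · by_cases hb : b ^ 2 = (β * (1 - lam) - 1) / (lam * s)
    · rw [hg, hg, ha, hb]
    · exact (key a b ha hb).le
  · by_contra hne
    have hopt : 0 ≤ (β * (1 - lam) - 1) / (lam * s) :=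
      div_nonneg (by linarith) (mul_pos hlam0 hs).le
    exact (key _ a (Real.sq_sqrt hopt) hne).not_ge (ha _)
end

section
/- Let d, m be positive integers, let Σ₁ and Σ₂ be d×d real symmetric positive-definite matrices such that Σ₂ − Σ₁ is positive semidefinite, and suppose β is a real number with 0 < β and β·(1−λ) ≤ 1 for every eigenvalue λ of Σ₁Σ₂⁻¹. Then for every m×d real matrix A, (1−β)·log det(AΣ₂Aᵀ + I_m) + β·log det(AΣ₁Aᵀ + I_m) ≥ 0; that is, the zero matrix A = 0 minimizes the Lagrangian 𝓛(A) = (1−β)·log det(AΣ₂Aᵀ + I_m) + β·log det(AΣ₁Aᵀ + I_m), whose value at A = 0 is 0. -/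
open Matrix

namespace Matrix

variable {n : Type*} [Fintype n] [DecidableEq n]

theorem IsHermitian.det_one_add_smul {A : Matrix n n ℝ} (hA : A.IsHermitian) (c : ℝ) :
    (1 + c • A).det = ∏ i, (1 + c * hA.eigenvalues i) := by
  have hU : (hA.eigenvectorUnitary : Matrix n n ℝ) * star (hA.eigenvectorUnitary : Matrix n n ℝ)
      = 1 := Unitary.coe_mul_star_self _
  have key : 1 + c • A = (hA.eigenvectorUnitary : Matrix n n ℝ) *
      diagonal (fun i ↦ 1 + c * hA.eigenvalues i) *
      star (hA.eigenvectorUnitary : Matrix n n ℝ) := by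
    have hd : diagonal (fun i ↦ 1 + c * hA.eigenvalues i)
        = 1 + c • diagonal (RCLike.ofReal ∘ hA.eigenvalues) := by
      ext i j
      by_cases h : i = j <;> simp [h]
    conv_lhs => rw [hA.spectral_theorem, Unitary.conjStarAlgAut_apply]
    rw [hd, mul_add, add_mul, mul_one, hU, mul_smul_comm, smul_mul_assoc]
  rw [key, det_mul_right_comm, hU, one_mul, det_diagonal]

theorem PosSemidef.one_le_det_one_add {A : Matrix n n ℝ} (hA : A.PosSemidef) :
    1 ≤ (1 + A).det := by
  have h := hA.1.det_one_add_smul 1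
  rw [one_smul] at h
  rw [h]
  exact Finset.one_le_prod fun i _ ↦ by linarith [hA.eigenvalues_nonneg i]

theorem PosDef.exists_unit_isHermitian_mul_self {P : Matrix n n ℝ} (hP : P.PosDef) :
    ∃ u : (Matrix n n ℝ)ˣ, (u : Matrix n n ℝ).IsHermitian ∧ P = u * u := by
  open scoped MatrixOrder Matrix.Norms.L2Operator in
  obtain ⟨b, ⟨u, rfl⟩, hb, h⟩ :=
    CStarAlgebra.isStrictlyPositive_iff_exists_isUnit_and_isSelfAdjoint_and_eq_mul_self.1
      (isStrictlyPositive_iff_posDef.2 hP)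
  exact ⟨u, hb, h⟩

theorem PosDef.det_le_det_of_posSemidef_sub {P Q : Matrix n n ℝ} (hP : P.PosDef)
    (h : (Q - P).PosSemidef) : P.det ≤ Q.det := by
  obtain ⟨u, hu, rfl⟩ := hP.exists_unit_isHermitian_mul_self
  have hu' : ((u⁻¹ : (Matrix n n ℝ)ˣ) : Matrix n n ℝ)ᴴ = (u⁻¹ : (Matrix n n ℝ)ˣ) := by
    rw [coe_units_inv]
    exact hu.inv
  have hN := h.conjTranspose_mul_mul_same ((u⁻¹ : (Matrix n n ℝ)ˣ) : Matrix n n ℝ)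
  rw [hu'] at hN
  have hQ : Q = u * (1 + (u⁻¹ : (Matrix n n ℝ)ˣ) * (Q - u * u) * (u⁻¹ : (Matrix n n ℝ)ˣ)) * u := by
    simp [mul_add, add_mul, mul_assoc]
  have hd : Q.det = (u * u : Matrix n n ℝ).det *
      (1 + (u⁻¹ : (Matrix n n ℝ)ˣ) * (Q - u * u) * (u⁻¹ : (Matrix n n ℝ)ˣ)).det := by
    conv_lhs => rw [hQ]
    simp only [det_mul]
    ring
  rw [hd]
  exact le_mul_of_one_le_right hP.det_pos.le hN.one_le_det_one_add

theorem PosDef.posSemidef_sub_smul_of_le_spectrum {S T : Matrix n n ℝ} (hT : T.PosDef)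
    (hS : S.IsHermitian) {c : ℝ} (h : ∀ t ∈ spectrum ℝ (S * T⁻¹), c ≤ t) :
    (S - c • T).PosSemidef := by
  obtain ⟨u, hu, rfl⟩ := hT.exists_unit_isHermitian_mul_self
  have hu' : ((u⁻¹ : (Matrix n n ℝ)ˣ) : Matrix n n ℝ)ᴴ = (u⁻¹ : (Matrix n n ℝ)ˣ) := by
    rw [coe_units_inv]
    exact hu.inv
  set v : Matrix n n ℝ := ((u⁻¹ : (Matrix n n ℝ)ˣ) : Matrix n n ℝ) with hv
  have hspec : spectrum ℝ (S * (u * u : Matrix n n ℝ)⁻¹) = spectrum ℝ (v * S * v) := by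
    rw [← spectrum.units_conjugate (R := ℝ) (a := v * S * v) (u := u), mul_inv_rev,
      ← coe_units_inv]
    simp [hv, mul_assoc]
  have hN : (v * S * v).IsHermitian := by
    have := isHermitian_conjTranspose_mul_mul v hS
    rwa [hu'] at this
  have hsub : (v * S * v - c • 1).PosSemidef := by
    rw [posSemidef_iff_isHermitian_and_spectrum_nonneg]
    refine ⟨hN.sub (by simp [IsHermitian]), fun t ht ↦ ?_⟩
    have ht' : c + t ∈ spectrum ℝ (v * S * v) := by
      rwa [add_comm, spectrum.add_mem_iff, neg_add_eq_sub, Algebra.algebraMap_eq_smul_one]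
    have := h _ (hspec ▸ ht')
    simpa using this
  have := hsub.conjTranspose_mul_mul_same (u : Matrix n n ℝ)
  rw [hu] at this
  convert this using 1
  simp [hv, mul_sub, sub_mul, mul_assoc]

theorem PosSemidef.mul_log_det_one_add_le {X : Matrix n n ℝ} (hX : X.PosSemidef) {c : ℝ}
    (hc₀ : 0 ≤ c) (hc₁ : c ≤ 1) :
    c * Real.log (1 + X).det ≤ Real.log (1 + c • X).det := by
  have h₁ := hX.1.det_one_add_smul 1
  simp only [one_smul, one_mul] at h₁
  have hpos (i) : 0 ≤ hX.1.eigenvalues i := hX.eigenvalues_nonneg i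
  have hcpos (i) : 0 < 1 + c * hX.1.eigenvalues i := by have := hpos i; positivity
  rw [h₁, hX.1.det_one_add_smul c, Real.log_prod fun i _ ↦ by linarith [hpos i],
    Real.log_prod fun i _ ↦ (hcpos i).ne', Finset.mul_sum]
  refine Finset.sum_le_sum fun i _ ↦ ?_
  have hi : 0 < 1 + hX.1.eigenvalues i := by linarith [hpos i]
  rw [← Real.log_rpow hi]
  exact Real.log_le_log (Real.rpow_pos_of_pos hi c)
    (rpow_one_add_le_one_add_mul_self (by linarith [hpos i]) hc₀ hc₁)

end Matrix

/-- **first branch of Theorem 1.** If `Σ₂ − Σ₁` is positive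
semidefinite, `β > 0`, and `β(1−λ) ≤ 1` for every eigenvalue `λ` of `Σ₁Σ₂⁻¹`,
then the Lagrangian `𝓛(A) = (1−β)·log det(AΣ₂Aᵀ+I) + β·log det(AΣ₁Aᵀ+I)` is
nonnegative for every `A`, i.e. it is minimized at `A = 0`, where it equals `0`. -/
theorem stmt_7 (d m : ℕ) (hd : 0 < d) (hm : 0 < m)
    (S1 S2 : Matrix (Fin d) (Fin d) ℝ)
    (hS1 : S1.PosDef) (hS2 : S2.PosDef)
    (hdiff : (S2 - S1).PosSemidef)
    (β : ℝ) (hβ : 0 < β)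
    (heig : ∀ lam ∈ spectrum ℝ (S1 * S2⁻¹), β * (1 - lam) ≤ 1) :
    (∀ A : Matrix (Fin m) (Fin d) ℝ,
      0 ≤ (1 - β) * Real.log (A * S2 * Aᵀ + 1).det
            + β * Real.log (A * S1 * Aᵀ + 1).det)
    ∧ (1 - β) * Real.log (((0 : Matrix (Fin m) (Fin d) ℝ) * S2
            * (0 : Matrix (Fin m) (Fin d) ℝ)ᵀ + 1).det)
        + β * Real.log (((0 : Matrix (Fin m) (Fin d) ℝ) * S1
            * (0 : Matrix (Fin m) (Fin d) ℝ)ᵀ + 1).det) = 0 := by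
  refine ⟨fun A ↦ ?_, by simp⟩
  rw [add_comm _ 1, add_comm _ 1]
  have hX : (A * S2 * Aᵀ).PosSemidef := hS2.posSemidef.mul_mul_conjTranspose_same A
  have hY : (A * S1 * Aᵀ).PosSemidef := hS1.posSemidef.mul_mul_conjTranspose_same A
  rcases le_total β 1 with hβ₁ | hβ₁
  · exact add_nonneg
      (mul_nonneg (sub_nonneg.2 hβ₁) (Real.log_nonneg hX.one_le_det_one_add))
      (mul_nonneg hβ.le (Real.log_nonneg hY.one_le_det_one_add))
  obtain ⟨c, hc⟩ : ∃ c, β * c = β - 1 := ⟨(β - 1) / β, by field_simp⟩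
  have hc₀ : 0 ≤ c := nonneg_of_mul_nonneg_right (by linarith) hβ
  have hc₁ : c ≤ 1 := le_of_mul_le_mul_left (by linarith) hβ
  have hsub : (S1 - c • S2).PosSemidef :=
    hS2.posSemidef_sub_smul_of_le_spectrum hS1.isHermitian fun t ht ↦
      le_of_mul_le_mul_left (by linarith [heig t ht]) hβ
  have hsub' : ((1 + A * S1 * Aᵀ) - (1 + c • (A * S2 * Aᵀ))).PosSemidef := by
    convert hsub.mul_mul_conjTranspose_same A using 1
    rw [add_sub_add_left_eq_sub, Matrix.mul_sub, Matrix.sub_mul, Matrix.mul_smul, Matrix.smul_mul,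
      conjTranspose_eq_transpose_of_trivial]
  have hP : (1 + c • (A * S2 * Aᵀ)).PosDef := PosDef.one.add_posSemidef (hX.smul hc₀)
  have hlog := (hX.mul_log_det_one_add_le hc₀ hc₁).trans
    (Real.log_le_log hP.det_pos (hP.det_le_det_of_posSemidef_sub hsub'))
  have := mul_le_mul_of_nonneg_left hlog hβ.le
  rw [← mul_assoc, hc] at this
  linarith
end

section
/- Let (Ω, ℱ, ℙ) be a probability space and let X, θ, T be random variables on Ω taking values in finite sets 𝒳, Θ, 𝒯 respectively, such that X is conditionally independent of T given θ. For θ₀ ∈ Θ with ℙ(θ = θ₀) > 0 write p(x | θ₀) = ℙ(X = x | θ = θ₀), and for t ∈ 𝒯 with ℙ(T = t) > 0 write p(x | t) = ℙ(X = x | T = t). Then Σ_{θ₀, t} ℙ(θ = θ₀, T = t) · ( −Σ_{x ∈ 𝒳} p(x | θ₀) · log p(x | t) ) = H(X | T), i.e., the expectation over (θ, T) of the cross-entropy loss H(p(·|θ) ‖ p(·|T)) equals the conditional entropy H(X | T). (Whenever ℙ(θ = θ₀, T = t) > 0 and p(x | θ₀) > 0, conditional independence forces p(x | t) > 0, so every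 summand is well defined.) -/
open MeasureTheory

/-- Probability of an event, as a real number. -/
noncomputable def pr {Ω : Type*} [MeasurableSpace Ω] (P : Measure Ω) (E : Set Ω) : ℝ :=
  (P E).toReal

/-- Conditional probability `ℙ(E | F) = ℙ(E ∩ F)/ℙ(F)`. -/
noncomputable def condPr {Ω : Type*} [MeasurableSpace Ω] (P : Measure Ω) (E F : Set Ω) : ℝ :=
  pr P (E ∩ F) / pr P F

/-- Shannon entropy (natural log) of a finite-valued random variable:
`H(X) = −∑ₓ ℙ(X = x)·log ℙ(X = x)`, with the convention `0·log 0 = 0`. -/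
noncomputable def entH {Ω S : Type*} [MeasurableSpace Ω] [Fintype S]
    (P : Measure Ω) (X : Ω → S) : ℝ :=
  ∑ x : S, Real.negMulLog (pr P (X ⁻¹' {x}))

/-- Conditional Shannon entropy `H(X | Y) = H(X, Y) − H(Y)`. -/
noncomputable def condEntH {Ω S U : Type*} [MeasurableSpace Ω] [Fintype S] [Fintype U]
    (P : Measure Ω) (X : Ω → S) (Y : Ω → U) : ℝ :=
  entH P (fun ω => (X ω, Y ω)) - entH P Y

/-- Mutual information `I(X; Y) = H(X) + H(Y) − H(X, Y)`. -/
noncomputable def mutInfH {Ω S U : Type*} [MeasurableSpace Ω] [Fintype S] [Fintype U]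
    (P : Measure Ω) (X : Ω → S) (Y : Ω → U) : ℝ :=
  entH P X + entH P Y - entH P (fun ω => (X ω, Y ω))

/-- `X` and `Z` are conditionally independent given `Y`:
`ℙ(X = x, Z = z | Y = y) = ℙ(X = x | Y = y)·ℙ(Z = z | Y = y)` whenever `ℙ(Y = y) > 0`. -/
def CondIndepFun {Ω A B C : Type*} [MeasurableSpace Ω]
    (P : Measure Ω) (X : Ω → A) (Z : Ω → B) (Y : Ω → C) : Prop :=
  ∀ (x : A) (z : B) (y : C), 0 < pr P (Y ⁻¹' {y}) →
    condPr P (X ⁻¹' {x} ∩ Z ⁻¹' {z}) (Y ⁻¹' {y})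
      = condPr P (X ⁻¹' {x}) (Y ⁻¹' {y}) * condPr P (Z ⁻¹' {z}) (Y ⁻¹' {y})

lemma pr_nonneg {Ω : Type*} [MeasurableSpace Ω] (P : Measure Ω) (E : Set Ω) : 0 ≤ pr P E :=
  ENNReal.toReal_nonneg

lemma pr_mono {Ω : Type*} [MeasurableSpace Ω] (P : Measure Ω) [IsFiniteMeasure P]
    {E F : Set Ω} (h : E ⊆ F) : pr P E ≤ pr P F :=
  measureReal_mono h

lemma pr_eq_zero_of_subset {Ω : Type*} [MeasurableSpace Ω] (P : Measure Ω) [IsFiniteMeasure P]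
    {E F : Set Ω} (h : E ⊆ F) (hF : pr P F = 0) : pr P E = 0 :=
  le_antisymm (hF ▸ pr_mono P h) (pr_nonneg P E)

/-- Law of total probability over the fibres of a finite-valued random variable. -/
lemma sum_pr_inter_preimage {Ω A : Type*} [MeasurableSpace Ω] [Fintype A]
    (P : Measure Ω) [IsFiniteMeasure P] (Y : Ω → A)
    (hY : ∀ a, MeasurableSet (Y ⁻¹' {a})) (E : Set Ω) :
    ∑ a, pr P (E ∩ Y ⁻¹' {a}) = pr P E := by
  have h := sum_measure_preimage_singleton (μ := P.restrict E) Finset.univ (f := Y)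
    fun a _ => hY a
  simp only [Measure.restrict_apply (hY _), Finset.coe_univ, Set.preimage_univ,
    Measure.restrict_apply_univ] at h
  simp only [pr, ← h, Set.inter_comm E]
  exact (ENNReal.toReal_sum fun a _ => measure_ne_top P _).symm

/-- Under conditional independence the joint law factors through the conditioning variable. -/
lemma CondIndepFun.pr_mul_condPr {Ω A B C : Type*} [MeasurableSpace Ω] {P : Measure Ω}
    [IsFiniteMeasure P] {X : Ω → A} {Z : Ω → B} {Y : Ω → C} (h : CondIndepFun P X Z Y)
    (x : A) (z : B) (y : C) :
    pr P (Y ⁻¹' {y} ∩ Z ⁻¹' {z}) * condPr P (X ⁻¹' {x}) (Y ⁻¹' {y})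
      = pr P ((X ⁻¹' {x} ∩ Z ⁻¹' {z}) ∩ Y ⁻¹' {y}) := by
  rcases (pr_nonneg P (Y ⁻¹' {y})).eq_or_lt with h0 | hpos
  · rw [pr_eq_zero_of_subset P Set.inter_subset_left h0.symm,
      pr_eq_zero_of_subset P Set.inter_subset_right h0.symm, zero_mul]
  · have hxz := h x z y hpos
    have hne := hpos.ne'
    simp only [condPr] at hxz ⊢
    rw [Set.inter_comm (Y ⁻¹' {y})]
    field_simp at hxz ⊢
    linarith

/-- The chain-rule definition of `H(X | Y)` agrees with the expected conditional surprisal. -/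
lemma condEntH_eq_sum {Ω S U : Type*} [MeasurableSpace Ω] [Fintype S] [Fintype U]
    (P : Measure Ω) [IsFiniteMeasure P] (X : Ω → S) (Y : Ω → U)
    (hX : ∀ x, MeasurableSet (X ⁻¹' {x})) :
    condEntH P X Y = ∑ y, ∑ x, -(pr P (X ⁻¹' {x} ∩ Y ⁻¹' {y})
      * Real.log (condPr P (X ⁻¹' {x}) (Y ⁻¹' {y}))) := by
  have hpair (x : S) (y : U) :
      (fun ω => (X ω, Y ω)) ⁻¹' {(x, y)} = X ⁻¹' {x} ∩ Y ⁻¹' {y} := by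
    ext ω
    simp
  simp only [condEntH, entH, Fintype.sum_prod_type_right, hpair]
  rw [← Finset.sum_sub_distrib]
  refine Finset.sum_congr rfl fun y _ => ?_
  have hmarg : Real.negMulLog (pr P (Y ⁻¹' {y}))
      = ∑ x, -(pr P (X ⁻¹' {x} ∩ Y ⁻¹' {y}) * Real.log (pr P (Y ⁻¹' {y}))) := by
    rw [Finset.sum_neg_distrib, ← Finset.sum_mul]
    simp only [Set.inter_comm _ (Y ⁻¹' {y})]
    rw [sum_pr_inter_preimage P X hX, Real.negMulLog, neg_mul]
  rw [hmarg, ← Finset.sum_sub_distrib]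
  refine Finset.sum_congr rfl fun x _ => ?_
  by_cases hxy : pr P (X ⁻¹' {x} ∩ Y ⁻¹' {y}) = 0
  · simp [hxy]
  · have hy : pr P (Y ⁻¹' {y}) ≠ 0 :=
      fun h0 => hxy (pr_eq_zero_of_subset P Set.inter_subset_right h0)
    rw [condPr, Real.log_div hxy hy, Real.negMulLog]
    ring

/-- If `X ⟂ T | θ` (Markov chain `X − θ − T`) for finite-valued
random variables, then the expectation over `(θ, T)` of the cross-entropy loss
`H(p(·|θ) ‖ p(·|T)) = −∑ₓ p(x|θ₀)·log p(x|t)` equals the conditional entropy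
`H(X | T)`. -/
theorem stmt_10 {Ω 𝒳 Θ' 𝒯 : Type*} [MeasurableSpace Ω]
    [Fintype 𝒳] [Fintype Θ'] [Fintype 𝒯]
    (P : Measure Ω) [IsProbabilityMeasure P]
    (X : Ω → 𝒳) (θ : Ω → Θ') (T : Ω → 𝒯)
    (hX : ∀ x, MeasurableSet (X ⁻¹' {x}))
    (hθ : ∀ t₀, MeasurableSet (θ ⁻¹' {t₀}))
    (hT : ∀ t, MeasurableSet (T ⁻¹' {t}))
    (hMarkov : CondIndepFun P X T θ) :
    ∑ θ₀ : Θ', ∑ t : 𝒯, pr P (θ ⁻¹' {θ₀} ∩ T ⁻¹' {t}) *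
        (-∑ x : 𝒳, condPr P (X ⁻¹' {x}) (θ ⁻¹' {θ₀})
            * Real.log (condPr P (X ⁻¹' {x}) (T ⁻¹' {t})))
      = condEntH P X T := by
  rw [condEntH_eq_sum P X T hX, Finset.sum_comm]
  refine Finset.sum_congr rfl fun t _ => ?_
  simp only [mul_neg, Finset.mul_sum, ← mul_assoc, hMarkov.pr_mul_condPr,
    Finset.sum_neg_distrib]
  rw [Finset.sum_comm]
  simp only [← Finset.sum_mul, sum_pr_inter_preimage P θ hθ]
end
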